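/- Consider N ≥ 2 agents with matrices A₁,…,A_N ∈ ℝ^{n×n} and biases b₁,…,b_N ∈ ℝⁿ, Laplacians ℒ_C, ℒ_P, ℒ_I of connected weighted undirected graphs on N nodes, and gains σ ≥ 0, σ_P > 0, σ_I > 0. Let Â = diag(A₁,…,A_N), B = (b₁ᵀ,…,b_Nᵀ)ᵀ, ℋ = σ·(ℒ_C ⊗ I_n) + σ_P·(ℒ_P ⊗ I_n), and define Ψ₁₁ = (1/N)·Σ_{k=1}^N A_k, μ = λ_max(Σ_{k=2}^N ((A_k + A_kᵀ) − (A₁ + A₁ᵀ))²), η = λ_max(Ψ₁₁ + Ψ₁₁ᵀ), and ρ = max_k λ_max(A_k + A_kᵀ). Assume: (i) Ψ₁₁ is invertible and Ψ₁₁ + Ψ₁₁ᵀ is negative definite; (ii) σ_P·λ₂(ℒ_P) > (1/2)·(μ/(N·|η|) + ρ) − σ·λ₂(ℒ_C); (iii) λ₂(ℒ_I) > 0. Then for every continuously differentiable pair of functions x : [0,∞) → ℝ^{nN}, z : [0,∞) → ℝ^{nN} satisfying ẋ(t) = (Â − ℋ)x(t) + z(t) + B and ż(t) = −σ_I·(ℒ_I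 ⊗ I_n)·x(t) with z(0) = 0, the state x(t) converges as t → ∞ to 𝟙_N ⊗ x_∞ with x_∞ = −(1/N)·Ψ₁₁⁻¹·Σ_{k=1}^N b_k (in particular ‖x_j(t) − x_i(t)‖ → 0 for all i, j), and z(t) remains bounded on [0,∞). -/

import Mathlib

open Matrix
open scoped Kronecker

noncomputable section

/-- The index `0` of `Fin N` when `N ≥ 2`. -/
def e0 {N : ℕ} (hN : 2 ≤ N) : Fin N := ⟨0, by omega⟩

/-- The embedding `Fin (N-1) → Fin N`, `i ↦ i + 1`. -/
def emb {N : ℕ} (hN : 2 ≤ N) (i : Fin (N - 1)) : Fin N :=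
  ⟨i.1 + 1, by have := i.2; omega⟩

/-- `L` is the Laplacian of a weighted undirected graph on `N` nodes. -/
def IsLaplacian {N : ℕ} (L : Matrix (Fin N) (Fin N) ℝ) : Prop :=
  ∃ A : Matrix (Fin N) (Fin N) ℝ, A.IsSymm ∧ (∀ i j, 0 ≤ A i j) ∧
    (∀ i, A i i = 0) ∧ L = Matrix.diagonal (fun i => ∑ j, A i j) - A

/-- `L` is the Laplacian of a *connected* weighted undirected graph: its
kernel is spanned by the all-ones vector. -/
def IsConnLaplacian {N : ℕ} (L : Matrix (Fin N) (Fin N) ℝ) : Prop :=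
  IsLaplacian L ∧ ∀ v : Fin N → ℝ, L.mulVec v = 0 → ∃ c : ℝ, v = fun _ => c

/-- The block-diagonal matrix `diag(A₁,…,A_N)` on `ℝ^{nN}`. -/
def blockDiag {N n : ℕ} (A : Fin N → Matrix (Fin n) (Fin n) ℝ) :
    Matrix (Fin N × Fin n) (Fin N × Fin n) ℝ :=
  Matrix.of fun p q => if p.1 = q.1 then A p.1 p.2 q.2 else 0

/-- The second-smallest eigenvalue of a graph Laplacian, characterised as
`min { vᵀLv : ‖v‖ = 1, vᵀ𝟙 = 0 }`. -/
def lambda2 {N : ℕ} (L : Matrix (Fin N) (Fin N) ℝ) : ℝ :=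
  sInf {r : ℝ | ∃ v : Fin N → ℝ,
    (∑ i, v i ^ 2) = 1 ∧ (∑ i, v i) = 0 ∧ r = v ⬝ᵥ L.mulVec v}

/-- The largest eigenvalue of a (symmetric) real matrix. -/
def lambdaMax {k : Type*} [Fintype k] (S : Matrix k k ℝ) : ℝ :=
  sSup {r : ℝ | ∃ v : k → ℝ, v ≠ 0 ∧ S.mulVec v = r • v}


section LambdaMax

variable {k : Type*} [Fintype k] {S : Matrix k k ℝ}

lemma finite_setOf_eigenvalue (S : Matrix k k ℝ) :
    {r : ℝ | ∃ v : k → ℝ, v ≠ 0 ∧ S.mulVec v = r • v}.Finite := by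
  refine (Module.End.finite_hasEigenvalue S.mulVecLin).subset ?_
  rintro r ⟨v, hv, h⟩
  exact Module.End.hasEigenvalue_of_hasEigenvector
    (Module.End.hasEigenvector_iff.2 ⟨Module.End.mem_eigenspace_iff.2 h, hv⟩)

lemma dotProduct_mulVec_le_lambdaMax (hS : S.IsHermitian) (v : k → ℝ) :
    v ⬝ᵥ S *ᵥ v ≤ lambdaMax S * (v ⬝ᵥ v) := by
  classical
  have hH : (lambdaMax S • (1 : Matrix k k ℝ) - S).IsHermitian := by
    refine Matrix.IsHermitian.sub ?_ hS
    simp [Matrix.IsHermitian]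
  have hpos : (lambdaMax S • (1 : Matrix k k ℝ) - S).PosSemidef := by
    rw [hH.posSemidef_iff_eigenvalues_nonneg]
    intro i
    have h := hH.mulVec_eigenvectorBasis i
    have hne : (hH.eigenvectorBasis i).ofLp ≠ 0 := by
      simpa using hH.eigenvectorBasis.orthonormal.ne_zero i
    have hmem : lambdaMax S - hH.eigenvalues i ≤ lambdaMax S := by
      refine le_csSup (finite_setOf_eigenvalue S).bddAbove ⟨_, hne, ?_⟩
      rw [Matrix.sub_mulVec, Matrix.smul_mulVec, Matrix.one_mulVec] at h
      rw [sub_smul, ← h]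
      abel
    simpa using hmem
  have := hpos.dotProduct_mulVec_nonneg v
  rw [Matrix.sub_mulVec, Matrix.smul_mulVec, Matrix.one_mulVec, dotProduct_sub, dotProduct_smul,
    star_trivial, smul_eq_mul] at this
  linarith

lemma exists_eigenvector_lambdaMax [Nonempty k] (hS : S.IsHermitian) :
    ∃ v : k → ℝ, v ≠ 0 ∧ S *ᵥ v = lambdaMax S • v := by
  classical
  refine Set.Nonempty.csSup_mem ?_ (finite_setOf_eigenvalue S)
  obtain ⟨i⟩ := ‹Nonempty k›
  exact ⟨_, _, by simpa using hS.eigenvectorBasis.orthonormal.ne_zero i,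
    hS.mulVec_eigenvectorBasis i⟩

lemma lambdaMax_neg_of_posDef_neg [Nonempty k] (hS : (-S).PosDef) : lambdaMax S < 0 := by
  have hS' : S.IsHermitian := by simpa using hS.isHermitian.neg
  obtain ⟨v, hv, h⟩ := exists_eigenvector_lambdaMax hS'
  have h1 := hS.dotProduct_mulVec_pos hv
  rw [Matrix.neg_mulVec, h, dotProduct_neg, dotProduct_smul, smul_eq_mul, star_trivial] at h1
  have h2 : 0 ≤ v ⬝ᵥ v := by simpa using dotProduct_star_self_nonneg v
  nlinarith

end LambdaMax

section Laplacian

variable {N : ℕ} {L : Matrix (Fin N) (Fin N) ℝ}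

lemma IsLaplacian.isSymm (h : IsLaplacian L) : L.IsSymm := by
  obtain ⟨A, hA, -, -, rfl⟩ := h
  exact (Matrix.isSymm_diagonal _).sub hA

lemma IsLaplacian.sum_row (h : IsLaplacian L) (i : Fin N) : ∑ j, L i j = 0 := by
  obtain ⟨A, -, -, -, rfl⟩ := h
  simp [Matrix.diagonal_apply]

lemma IsLaplacian.sum_col (h : IsLaplacian L) (j : Fin N) : ∑ i, L i j = 0 := by
  rw [← h.sum_row j]
  exact Finset.sum_congr rfl fun i _ => h.isSymm.apply j i

lemma IsLaplacian.mulVec_const (h : IsLaplacian L) (c : ℝ) : L *ᵥ (fun _ => c) = 0 := by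
  ext i
  simp [Matrix.mulVec, dotProduct, ← Finset.sum_mul, h.sum_row]

lemma IsLaplacian.sum_mulVec (h : IsLaplacian L) (v : Fin N → ℝ) : ∑ i, (L *ᵥ v) i = 0 := by
  simp only [Matrix.mulVec, dotProduct]
  rw [Finset.sum_comm]
  simp [← Finset.sum_mul, h.sum_col]

lemma IsLaplacian.dotProduct_mulVec_nonneg (h : IsLaplacian L) (v : Fin N → ℝ) :
    0 ≤ v ⬝ᵥ L *ᵥ v := by
  obtain ⟨A, hA, hpos, -, rfl⟩ := h
  have h1 : v ⬝ᵥ (Matrix.diagonal (fun i => ∑ j, A i j) - A) *ᵥ v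
      = ∑ i, ∑ j, A i j * (v i * v i - v i * v j) := by
    rw [Matrix.sub_mulVec]
    refine Finset.sum_congr rfl fun i _ => ?_
    rw [Pi.sub_apply, Matrix.mulVec_diagonal, Matrix.mulVec, dotProduct, Finset.sum_mul,
      ← Finset.sum_sub_distrib, Finset.mul_sum]
    exact Finset.sum_congr rfl fun j _ => by ring
  have h2 : ∑ i, ∑ j, A i j * (v i * v i - v i * v j)
      = ∑ i, ∑ j, A i j * (v j * v j - v i * v j) := by
    rw [Finset.sum_comm]
    refine Finset.sum_congr rfl fun i _ => Finset.sum_congr rfl fun j _ => ?_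
    rw [hA.apply i j]
    ring
  have h3 : 0 ≤ ∑ i, ∑ j, A i j * (v i * v i - v i * v j)
      + ∑ i, ∑ j, A i j * (v j * v j - v i * v j) := by
    simp only [← Finset.sum_add_distrib]
    refine Finset.sum_nonneg fun i _ => Finset.sum_nonneg fun j _ => ?_
    nlinarith [mul_nonneg (hpos i j) (sq_nonneg (v i - v j))]
  linarith

lemma IsLaplacian.lambda2_mul_le (h : IsLaplacian L) {v : Fin N → ℝ} (hv : ∑ i, v i = 0) :
    lambda2 L * (v ⬝ᵥ v) ≤ v ⬝ᵥ L *ᵥ v := by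
  have hvv : v ⬝ᵥ v = ∑ i, v i ^ 2 := by simp [dotProduct, sq]
  have h0 : 0 ≤ v ⬝ᵥ v := by rw [hvv]; positivity
  rcases h0.eq_or_lt with h0 | h0
  · rw [← h0, mul_zero]
    exact h.dotProduct_mulVec_nonneg v
  set s := Real.sqrt (v ⬝ᵥ v) with hs
  have hs0 : 0 < s := Real.sqrt_pos.2 h0
  have hss : s ^ 2 = v ⬝ᵥ v := Real.sq_sqrt h0.le
  have hle : lambda2 L ≤ (s⁻¹ • v) ⬝ᵥ L *ᵥ (s⁻¹ • v) := by
    refine csInf_le ⟨0, ?_⟩ ⟨s⁻¹ • v, ?_, ?_, rfl⟩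
    · rintro r ⟨w, -, -, rfl⟩
      exact h.dotProduct_mulVec_nonneg w
    · simp only [Pi.smul_apply, smul_eq_mul, mul_pow, ← Finset.mul_sum]
      rw [← hvv, ← hss]
      field_simp
    · simp [← Finset.mul_sum, hv]
  rw [Matrix.mulVec_smul, smul_dotProduct, dotProduct_smul, smul_eq_mul, smul_eq_mul] at hle
  rw [← hss]
  calc lambda2 L * s ^ 2 ≤ s⁻¹ * (s⁻¹ * (v ⬝ᵥ L *ᵥ v)) * s ^ 2 := by gcongr
    _ = v ⬝ᵥ L *ᵥ v := by field_simp

/-- Adding the all-ones matrix removes the kernel of the Laplacian of a connected graph. -/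
lemma IsLaplacian.posDef_smul_add_ones (h : IsLaplacian L) (h2 : 0 < lambda2 L) {s : ℝ}
    (hs : 0 < s) : (s • L + Matrix.of fun _ _ => (1 : ℝ)).PosDef := by
  refine .of_dotProduct_mulVec_pos ?_ fun v hv => ?_
  · ext i j
    simp [h.isSymm.apply i j]
  · have hq : star v ⬝ᵥ (s • L + Matrix.of fun _ _ => (1 : ℝ)) *ᵥ v
        = s * (v ⬝ᵥ L *ᵥ v) + (∑ i, v i) ^ 2 := by
      rw [star_trivial, Matrix.add_mulVec, Matrix.smul_mulVec, dotProduct_add, dotProduct_smul,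
        smul_eq_mul, sq]
      simp [Matrix.mulVec, dotProduct, Finset.sum_mul]
    rw [hq]
    have h1 := mul_nonneg hs.le (h.dotProduct_mulVec_nonneg v)
    by_cases h0 : ∑ i, v i = 0
    · have hvv : 0 < v ⬝ᵥ v := by simpa using Matrix.dotProduct_star_self_pos_iff.2 hv
      have h3 := h.lambda2_mul_le h0
      have h4 : 0 < v ⬝ᵥ L *ᵥ v := (mul_pos h2 hvv).trans_le h3
      positivity
    · positivity

end Laplacian

section Lyapunov

/-- A damped system coupled to an integrator, in the form met in proportional-integral control,
converges exponentially: `‖x‖² + ⟪z, Q z⟫ - 2ε⟪x, z⟫` is a strict Lyapunov function for small `ε`. -/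
lemma exists_exp_bound_of_coupled {E : Type*} [NormedAddCommGroup E] [InnerProductSpace ℝ E]
    (M K Q : E →L[ℝ] E) (hQs : ∀ u v, inner ℝ (Q u) v = inner ℝ u (Q v))
    {q c : ℝ} (hq : 0 < q) (hc : 0 < c) (hQ : ∀ v, q * ‖v‖ ^ 2 ≤ inner ℝ v (Q v))
    (hM : ∀ v, inner ℝ v (M v) ≤ -c * ‖v‖ ^ 2) {x z : ℝ → E}
    (hx : ∀ t ∈ Set.Ici (0 : ℝ), HasDerivWithinAt x (M (x t) + z t) (Set.Ici 0) t)
    (hz : ∀ t ∈ Set.Ici (0 : ℝ), HasDerivWithinAt z (-K (x t)) (Set.Ici 0) t)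
    (hxz : ∀ t ∈ Set.Ici (0 : ℝ), inner ℝ (z t) (Q (K (x t))) = inner ℝ (z t) (x t)) :
    ∃ C γ : ℝ, 0 < γ ∧ ∀ t ∈ Set.Ici (0 : ℝ), ‖x t‖ ^ 2 + ‖z t‖ ^ 2 ≤ C * Real.exp (-(γ * t)) := by
  obtain ⟨ε, hε, hε1, hε2, hε3⟩ : ∃ ε : ℝ, 0 < ε ∧ ε ≤ c / (‖M‖ ^ 2 + 2 * ‖K‖ + 1) ∧
      ε ≤ 1 / 2 ∧ ε ≤ q / 2 := by
    refine ⟨min (c / (‖M‖ ^ 2 + 2 * ‖K‖ + 1)) (min (1 / 2) (q / 2)), ?_, min_le_left _ _,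
      (min_le_right _ _).trans (min_le_left _ _), (min_le_right _ _).trans (min_le_right _ _)⟩
    have : 0 < ‖M‖ ^ 2 + 2 * ‖K‖ + 1 := by positivity
    positivity
  rw [le_div_iff₀ (by positivity)] at hε1
  set V : ℝ → ℝ := fun t => inner ℝ (x t) (x t) + inner ℝ (z t) (Q (z t)) -
    2 * ε * inner ℝ (x t) (z t) with hV
  set V' : ℝ → ℝ := fun t => 2 * inner ℝ (x t) (M (x t)) -
    2 * ε * (inner ℝ (M (x t)) (z t) + ‖z t‖ ^ 2 - inner ℝ (x t) (K (x t))) with hV'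
  set D : ℝ := 2 + ‖Q‖ with hD
  have hDpos : 0 < D := by positivity
  have hder : ∀ t ∈ Set.Ici (0 : ℝ), HasDerivWithinAt V (V' t) (Set.Ici 0) t := by
    intro t ht
    have hQz : HasDerivWithinAt (fun s => Q (z s)) (Q (-K (x t))) (Set.Ici 0) t :=
      Q.hasFDerivAt.comp_hasDerivWithinAt t (hz t ht)
    refine ((((hx t ht).inner ℝ (hx t ht)).add ((hz t ht).inner ℝ hQz)).sub
      (((hx t ht).inner ℝ (hz t ht)).const_mul (2 * ε))).congr_deriv ?_
    simp only [hV', inner_add_right, inner_add_left, map_neg, inner_neg_right, inner_neg_left,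
      real_inner_self_eq_norm_sq, ← hQs (K (x t)), hxz t ht, real_inner_comm (z t) (Q (K (x t))),
      real_inner_comm (x t) (M (x t)), real_inner_comm (z t) (x t)]
    ring
  have hab : ∀ u v : E, 2 * |inner ℝ u v| ≤ ‖u‖ ^ 2 + ‖v‖ ^ 2 := fun u v => by
    nlinarith [abs_real_inner_le_norm u v, sq_nonneg (‖u‖ - ‖v‖)]
  have hV'le : ∀ t, V' t ≤ -ε * (‖x t‖ ^ 2 + ‖z t‖ ^ 2) := by
    intro t
    have h1 := hM (x t)
    have h2 : -(2 * inner ℝ (M (x t)) (z t)) ≤ ‖M‖ ^ 2 * ‖x t‖ ^ 2 + ‖z t‖ ^ 2 := by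
      have h3 : ‖M (x t)‖ ^ 2 ≤ ‖M‖ ^ 2 * ‖x t‖ ^ 2 := by
        rw [← mul_pow]
        gcongr
        exact M.le_opNorm _
      linarith [hab (M (x t)) (z t), neg_abs_le (inner ℝ (M (x t)) (z t))]
    have h4 : inner ℝ (x t) (K (x t)) ≤ ‖K‖ * ‖x t‖ ^ 2 := by
      refine (real_inner_le_norm _ _).trans ?_
      have := mul_le_mul_of_nonneg_left (K.le_opNorm (x t)) (norm_nonneg (x t))
      linarith
    have h5 := mul_le_mul_of_nonneg_right hε1 (sq_nonneg ‖x t‖)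
    have h6 := mul_le_mul_of_nonneg_left h2 hε.le
    have h7 := mul_le_mul_of_nonneg_left h4 hε.le
    have h8 := mul_nonneg hc.le (sq_nonneg ‖x t‖)
    simp only [hV']
    linarith
  have hVlow : ∀ t, min (1 / 2) (q / 2) * (‖x t‖ ^ 2 + ‖z t‖ ^ 2) ≤ V t := by
    intro t
    have h1 := hQ (z t)
    have h2 := mul_le_mul_of_nonneg_left
      ((mul_le_mul_of_nonneg_left (le_abs_self (inner ℝ (x t) (z t))) zero_le_two).trans
        (hab (x t) (z t))) hε.le
    have h3 := mul_le_mul_of_nonneg_right hε2 (sq_nonneg ‖x t‖)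
    have h4 := mul_le_mul_of_nonneg_right hε3 (sq_nonneg ‖z t‖)
    have h5 := mul_le_mul_of_nonneg_right (min_le_left (1 / 2) (q / 2)) (sq_nonneg ‖x t‖)
    have h6 := mul_le_mul_of_nonneg_right (min_le_right (1 / 2) (q / 2)) (sq_nonneg ‖z t‖)
    simp only [hV, real_inner_self_eq_norm_sq]
    linarith
  have hVup : ∀ t, V t ≤ D * (‖x t‖ ^ 2 + ‖z t‖ ^ 2) := by
    intro t
    have h1 : inner ℝ (z t) (Q (z t)) ≤ ‖Q‖ * ‖z t‖ ^ 2 := by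
      refine (real_inner_le_norm _ _).trans ?_
      have := mul_le_mul_of_nonneg_left (Q.le_opNorm (z t)) (norm_nonneg (z t))
      linarith
    have h2 : -(2 * ε * inner ℝ (x t) (z t)) ≤ ‖x t‖ ^ 2 + ‖z t‖ ^ 2 := by
      have := hab (x t) (z t)
      nlinarith [neg_abs_le (inner ℝ (x t) (z t)), abs_nonneg (inner ℝ (x t) (z t))]
    have h3 : 0 ≤ ‖Q‖ * ‖x t‖ ^ 2 := by positivity
    simp only [hV, hD, real_inner_self_eq_norm_sq]
    nlinarith [sq_nonneg ‖z t‖]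
  set γ : ℝ := ε / D with hγ
  have hγpos : 0 < γ := by positivity
  have hanti : AntitoneOn (fun t => V t * Real.exp (γ * t)) (Set.Ici 0) := by
    have hd : ∀ t ∈ Set.Ici (0 : ℝ), HasDerivWithinAt (fun t => V t * Real.exp (γ * t))
        (V' t * Real.exp (γ * t) + V t * (Real.exp (γ * t) * (γ * 1))) (Set.Ici 0) t :=
      fun t ht => (hder t ht).mul ((hasDerivAt_id t).const_mul γ).exp.hasDerivWithinAt
    refine antitoneOn_of_hasDerivWithinAt_nonpos (convex_Ici 0)
      (fun t ht => (hd t ht).continuousWithinAt)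
      (fun t ht => (hd t (interior_subset ht)).mono interior_subset) fun t _ => ?_
    have h1 : γ * V t ≤ ε * (‖x t‖ ^ 2 + ‖z t‖ ^ 2) := by
      refine (mul_le_mul_of_nonneg_left (hVup t) hγpos.le).trans_eq ?_
      rw [hγ]
      field_simp
    have h2 : V' t + γ * V t ≤ 0 := by linarith [hV'le t]
    have h3 := mul_nonpos_of_nonpos_of_nonneg h2 (Real.exp_pos (γ * t)).le
    linarith
  set p : ℝ := min (1 / 2) (q / 2) with hp
  have hppos : 0 < p := by positivity
  refine ⟨V 0 / p, γ, hγpos, fun t ht => ?_⟩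
  have h1 := hanti Set.self_mem_Ici ht ht
  simp only [mul_zero, Real.exp_zero, mul_one] at h1
  rw [Real.exp_neg, div_mul_eq_mul_div, le_div_iff₀ hppos, ← div_eq_mul_inv,
    le_div_iff₀ (Real.exp_pos _), mul_comm _ p]
  exact (mul_le_mul_of_nonneg_right (hVlow t) (Real.exp_pos _).le).trans h1

lemma exists_exp_bound_of_coupled_mulVec {ι : Type*} [Fintype ι] [Nonempty ι]
    {M K Q : Matrix ι ι ℝ} (hQ : Q.PosDef) {c : ℝ} (hc : 0 < c)
    (hM : ∀ v, v ⬝ᵥ M *ᵥ v ≤ -c * (v ⬝ᵥ v)) {x z : ℝ → ι → ℝ}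
    (hx : ∀ t ∈ Set.Ici (0 : ℝ), HasDerivWithinAt x (M *ᵥ x t + z t) (Set.Ici 0) t)
    (hz : ∀ t ∈ Set.Ici (0 : ℝ), HasDerivWithinAt z (-(K *ᵥ x t)) (Set.Ici 0) t)
    (hxz : ∀ t ∈ Set.Ici (0 : ℝ), z t ⬝ᵥ Q *ᵥ (K *ᵥ x t) = z t ⬝ᵥ x t) :
    ∃ C γ : ℝ, 0 < γ ∧ ∀ t ∈ Set.Ici (0 : ℝ), ‖x t‖ ^ 2 + ‖z t‖ ^ 2 ≤ C * Real.exp (-(γ * t)) := by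
  classical
  have hQs : Qᵀ = Q := by simpa using hQ.isHermitian.eq
  have hinner : ∀ u v : EuclideanSpace ℝ ι, inner ℝ u v = u.ofLp ⬝ᵥ v.ofLp := fun u v => by
    rw [EuclideanSpace.inner_eq_star_dotProduct, star_trivial, dotProduct_comm]
  have hnorm : ∀ u : EuclideanSpace ℝ ι, ‖u‖ ^ 2 = u.ofLp ⬝ᵥ u.ofLp := fun u => by
    rw [← hinner, real_inner_self_eq_norm_sq]
  have happly : ∀ (P : Matrix ι ι ℝ) (u : EuclideanSpace ℝ ι),
      (Matrix.toEuclideanCLM (𝕜 := ℝ) P u).ofLp = P *ᵥ u.ofLp := fun P u => by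
    rw [← Matrix.ofLp_toEuclideanCLM]
  have hsup : ∀ u : ι → ℝ, ‖u‖ ≤ ‖WithLp.toLp 2 u‖ := fun u =>
    (pi_norm_le_iff_of_nonneg (norm_nonneg _)).2 fun i => PiLp.norm_apply_le (WithLp.toLp 2 u) i
  have hderiv : ∀ {f : ℝ → ι → ℝ} {f' : ι → ℝ} {t : ℝ}, HasDerivWithinAt f f' (Set.Ici 0) t →
      HasDerivWithinAt (fun s => WithLp.toLp 2 (f s)) (WithLp.toLp 2 f') (Set.Ici 0) t :=
    fun {f f' t} h =>
      ((PiLp.continuousLinearEquiv 2 ℝ (fun _ : ι => ℝ)).symm.hasFDerivAt).comp_hasDerivWithinAt t h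
  obtain ⟨C, γ, hγ, h⟩ := exists_exp_bound_of_coupled (Matrix.toEuclideanCLM (𝕜 := ℝ) M)
    (Matrix.toEuclideanCLM (𝕜 := ℝ) K) (Matrix.toEuclideanCLM (𝕜 := ℝ) Q)
    (q := -lambdaMax (-Q)) (c := c) (x := fun t => WithLp.toLp 2 (x t))
    (z := fun t => WithLp.toLp 2 (z t))
    (fun u v => by
      rw [hinner, hinner, happly, happly, Matrix.dotProduct_mulVec, ← Matrix.mulVec_transpose, hQs])
    (neg_pos.2 (lambdaMax_neg_of_posDef_neg (by rwa [neg_neg]))) hc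
    (fun v => by
      have := dotProduct_mulVec_le_lambdaMax hQ.isHermitian.neg v.ofLp
      rw [Matrix.neg_mulVec, dotProduct_neg] at this
      rw [hinner, hnorm, happly]
      linarith)
    (fun v => by rw [hinner, hnorm, happly]; exact hM _)
    (fun t ht => by simpa [Matrix.toEuclideanCLM_toLp] using hderiv (hx t ht))
    (fun t ht => by simpa [Matrix.toEuclideanCLM_toLp] using hderiv (hz t ht))
    (fun t ht => by simpa [hinner, happly] using hxz t ht)
  refine ⟨C, γ, hγ, fun t ht => (add_le_add ?_ ?_).trans (h t ht)⟩ <;>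
    exact pow_le_pow_left₀ (norm_nonneg _) (hsup _) 2

end Lyapunov

section Dissipation

variable {N n : ℕ}

lemma sum_eq_e0_add_sum_emb {M : Type*} [AddCommMonoid M] (hN : 2 ≤ N) (f : Fin N → M) :
    ∑ k, f k = f (e0 hN) + ∑ j, f (emb hN j) := by
  obtain ⟨N, rfl⟩ := Nat.exists_eq_add_of_le' (show 1 ≤ N by omega)
  exact Fin.sum_univ_succ f

lemma kronecker_one_mulVec_apply (L : Matrix (Fin N) (Fin N) ℝ) (v : Fin N × Fin n → ℝ)
    (k : Fin N) (j : Fin n) :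
    ((L ⊗ₖ (1 : Matrix (Fin n) (Fin n) ℝ)) *ᵥ v) (k, j) = (L *ᵥ fun i => v (i, j)) k := by
  simp [Matrix.mulVec, dotProduct, Fintype.sum_prod_type, Matrix.one_apply]

lemma blockDiag_mulVec_apply (A : Fin N → Matrix (Fin n) (Fin n) ℝ) (v : Fin N × Fin n → ℝ)
    (k : Fin N) (j : Fin n) :
    (blockDiag A *ᵥ v) (k, j) = (A k *ᵥ fun i => v (k, i)) j := by
  simp [_root_.blockDiag, Matrix.mulVec, dotProduct, Fintype.sum_prod_type, ite_mul]

lemma IsLaplacian.kronecker_one_mulVec_const {L : Matrix (Fin N) (Fin N) ℝ} (h : IsLaplacian L)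
    (w : Fin n → ℝ) :
    (L ⊗ₖ (1 : Matrix (Fin n) (Fin n) ℝ)) *ᵥ (fun p => w p.2) = 0 := by
  ext ⟨k, j⟩
  rw [kronecker_one_mulVec_apply]
  exact congrFun (h.mulVec_const (w j)) k

lemma IsLaplacian.lambda2_mul_le_kronecker {L : Matrix (Fin N) (Fin N) ℝ} (h : IsLaplacian L)
    (m : Fin n → ℝ) {e : Fin N → Fin n → ℝ} (he : ∑ k, e k = 0) :
    lambda2 L * ∑ k, e k ⬝ᵥ e k ≤ (fun p : Fin N × Fin n => m p.2 + e p.1 p.2) ⬝ᵥ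
      (L ⊗ₖ (1 : Matrix (Fin n) (Fin n) ℝ)) *ᵥ (fun p => m p.2 + e p.1 p.2) := by
  have he' : ∀ j, ∑ k, e k j = 0 := fun j => by simpa using congrFun he j
  have h1 : (L ⊗ₖ (1 : Matrix (Fin n) (Fin n) ℝ)) *ᵥ (fun p => m p.2 + e p.1 p.2)
      = fun p => (L *ᵥ fun k => e k p.2) p.1 := by
    ext ⟨k, j⟩
    rw [kronecker_one_mulVec_apply]
    change (L *ᵥ ((fun _ => m j) + fun k => e k j)) k = _
    rw [Matrix.mulVec_add, h.mulVec_const, zero_add]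
  have h2 : (fun p : Fin N × Fin n => m p.2 + e p.1 p.2) ⬝ᵥ
      (fun p => (L *ᵥ fun k => e k p.2) p.1)
      = ∑ j, (fun k => e k j) ⬝ᵥ L *ᵥ (fun k => e k j) := by
    simp only [dotProduct, Fintype.sum_prod_type_right]
    refine Finset.sum_congr rfl fun j _ => ?_
    simp only [add_mul, Finset.sum_add_distrib, ← Finset.mul_sum, h.sum_mulVec, mul_zero, zero_add]
  have h3 : ∑ k, e k ⬝ᵥ e k = ∑ j, (fun k => e k j) ⬝ᵥ (fun k => e k j) := by
    simp only [dotProduct]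
    exact Finset.sum_comm
  rw [h1, h2, h3, Finset.mul_sum]
  exact Finset.sum_le_sum fun j _ => h.lambda2_mul_le (he' j)

lemma dotProduct_mulVec_comm_of_isSymm {S : Matrix (Fin n) (Fin n) ℝ} (hS : S.IsSymm)
    (u v : Fin n → ℝ) : u ⬝ᵥ S *ᵥ v = S *ᵥ u ⬝ᵥ v := by
  rw [Matrix.dotProduct_mulVec, ← Matrix.mulVec_transpose, hS.eq]

lemma dotProduct_sum_sq_mulVec {ι : Type*} (s : Finset ι) {D : ι → Matrix (Fin n) (Fin n) ℝ}
    (hD : ∀ j, (D j).IsSymm) (m : Fin n → ℝ) :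
    m ⬝ᵥ (∑ j ∈ s, D j ^ 2) *ᵥ m = ∑ j ∈ s, (D j *ᵥ m) ⬝ᵥ (D j *ᵥ m) := by
  rw [Matrix.sum_mulVec, dotProduct_sum]
  refine Finset.sum_congr rfl fun j _ => ?_
  rw [sq, ← Matrix.mulVec_mulVec, dotProduct_mulVec_comm_of_isSymm (hD j)]

lemma isHermitian_sum_sq {ι : Type*} (s : Finset ι) {D : ι → Matrix (Fin n) (Fin n) ℝ}
    (hD : ∀ j, (D j).IsSymm) : (∑ j ∈ s, D j ^ 2).IsHermitian := by
  rw [Matrix.IsHermitian, Matrix.conjTranspose_sum]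
  refine Finset.sum_congr rfl fun j _ => ?_
  rw [Matrix.conjTranspose_pow, Matrix.conjTranspose_eq_transpose_of_trivial, (hD j).eq]

lemma lambdaMax_sum_sq_nonneg [Nonempty (Fin n)] {ι : Type*} (s : Finset ι)
    {D : ι → Matrix (Fin n) (Fin n) ℝ} (hD : ∀ j, (D j).IsSymm) :
    0 ≤ lambdaMax (∑ j ∈ s, D j ^ 2) := by
  obtain ⟨v, hv, h⟩ := exists_eigenvector_lambdaMax (isHermitian_sum_sq s hD)
  have h1 := dotProduct_sum_sq_mulVec s hD v
  rw [h, dotProduct_smul, smul_eq_mul] at h1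
  have h2 : 0 < v ⬝ᵥ v := by simpa using Matrix.dotProduct_star_self_pos_iff.2 hv
  refine nonneg_of_mul_nonneg_left (b := v ⬝ᵥ v) ?_ h2
  rw [h1]
  exact Finset.sum_nonneg fun j _ => by simpa using dotProduct_star_self_nonneg (D j *ᵥ v)

lemma two_mul_dotProduct_le {θ : ℝ} (hθ : 0 < θ) (u v : Fin n → ℝ) :
    2 * (u ⬝ᵥ v) ≤ θ * (u ⬝ᵥ u) + θ⁻¹ * (v ⬝ᵥ v) := by
  simp only [dotProduct, Finset.mul_sum, ← Finset.sum_add_distrib]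
  refine Finset.sum_le_sum fun i _ => ?_
  have h : θ * (u i * u i) + θ⁻¹ * (v i * v i) - 2 * (u i * v i) = θ⁻¹ * (θ * u i - v i) ^ 2 := by
    field_simp
    ring
  have : 0 ≤ θ⁻¹ * (θ * u i - v i) ^ 2 := by positivity
  linarith

/-- Splitting the state into its average `m` and the disagreements `e k`, the cross terms only
involve the differences of the `S k`, and are absorbed by Young's inequality with weight `θ`. -/
lemma sum_dotProduct_mulVec_le (hN : 2 ≤ N) {S : Fin N → Matrix (Fin n) (Fin n) ℝ}
    (hS : ∀ k, (S k).IsSymm) (m : Fin n → ℝ) {e : Fin N → Fin n → ℝ} (he : ∑ k, e k = 0)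
    {θ ρ : ℝ} (hθ : 0 < θ) (hρ : ∀ k, lambdaMax (S k) ≤ ρ) :
    ∑ k, (m + e k) ⬝ᵥ S k *ᵥ (m + e k) ≤ m ⬝ᵥ (∑ k, S k) *ᵥ m +
      θ * lambdaMax (∑ j, (S (emb hN j) - S (e0 hN)) ^ 2) * (m ⬝ᵥ m) +
      (θ⁻¹ + ρ) * ∑ k, e k ⬝ᵥ e k := by
  have hD : ∀ j, (S (emb hN j) - S (e0 hN)).IsSymm := fun j => (hS _).sub (hS _)
  have hnn : ∀ u : Fin n → ℝ, 0 ≤ u ⬝ᵥ u := fun u => by simpa using dotProduct_star_self_nonneg u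
  have hexp : ∑ k, (m + e k) ⬝ᵥ S k *ᵥ (m + e k) = m ⬝ᵥ (∑ k, S k) *ᵥ m +
      2 * ∑ k, S k *ᵥ m ⬝ᵥ e k + ∑ k, e k ⬝ᵥ S k *ᵥ e k := by
    rw [Matrix.sum_mulVec, dotProduct_sum, Finset.mul_sum, ← Finset.sum_add_distrib,
      ← Finset.sum_add_distrib]
    refine Finset.sum_congr rfl fun k _ => ?_
    rw [Matrix.mulVec_add, add_dotProduct, dotProduct_add, dotProduct_add,
      dotProduct_mulVec_comm_of_isSymm (hS k) m (e k), dotProduct_comm (e k) (S k *ᵥ m)]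
    ring
  have hcross : ∑ k, S k *ᵥ m ⬝ᵥ e k
      = ∑ j, (S (emb hN j) - S (e0 hN)) *ᵥ m ⬝ᵥ e (emb hN j) := by
    have h0 : S (e0 hN) *ᵥ m ⬝ᵥ ∑ k, e k = 0 := by rw [he, dotProduct_zero]
    rw [sum_eq_e0_add_sum_emb hN, dotProduct_add, dotProduct_sum] at h0
    rw [sum_eq_e0_add_sum_emb hN]
    simp only [Matrix.sub_mulVec, sub_dotProduct, Finset.sum_sub_distrib]
    linarith
  have hyoung : 2 * ∑ k, S k *ᵥ m ⬝ᵥ e k ≤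
      θ * (m ⬝ᵥ (∑ j, (S (emb hN j) - S (e0 hN)) ^ 2) *ᵥ m) + θ⁻¹ * ∑ k, e k ⬝ᵥ e k := by
    have h1 : ∑ j, e (emb hN j) ⬝ᵥ e (emb hN j) ≤ ∑ k, e k ⬝ᵥ e k := by
      rw [sum_eq_e0_add_sum_emb hN fun k => e k ⬝ᵥ e k]
      linarith [hnn (e (e0 hN))]
    refine le_trans ?_ (add_le_add_right (mul_le_mul_of_nonneg_left h1 (inv_nonneg.2 hθ.le)) _)
    rw [hcross, dotProduct_sum_sq_mulVec _ hD, Finset.mul_sum, Finset.mul_sum, Finset.mul_sum,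
      ← Finset.sum_add_distrib]
    exact Finset.sum_le_sum fun j _ => two_mul_dotProduct_le hθ _ _
  have hmu := mul_le_mul_of_nonneg_left
    (dotProduct_mulVec_le_lambdaMax (isHermitian_sum_sq Finset.univ hD) m) hθ.le
  have hrho : ∑ k, e k ⬝ᵥ S k *ᵥ e k ≤ ρ * ∑ k, e k ⬝ᵥ e k := by
    rw [Finset.mul_sum]
    refine Finset.sum_le_sum fun k _ => ?_
    have hH : (S k).IsHermitian := by
      rw [Matrix.IsHermitian, Matrix.conjTranspose_eq_transpose_of_trivial, (hS k).eq]
    exact (dotProduct_mulVec_le_lambdaMax hH (e k)).trans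
      (mul_le_mul_of_nonneg_right (hρ k) (hnn _))
  rw [hexp]
  linarith

lemma two_mul_dotProduct_blockDiag_mulVec (A : Fin N → Matrix (Fin n) (Fin n) ℝ)
    (u : Fin N → Fin n → ℝ) :
    2 * ((fun p : Fin N × Fin n => u p.1 p.2) ⬝ᵥ blockDiag A *ᵥ (fun p => u p.1 p.2))
      = ∑ k, u k ⬝ᵥ (A k + (A k)ᵀ) *ᵥ u k := by
  have h : (fun p : Fin N × Fin n => u p.1 p.2) ⬝ᵥ blockDiag A *ᵥ (fun p => u p.1 p.2)
      = ∑ k, u k ⬝ᵥ A k *ᵥ u k := by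
    rw [dotProduct, Fintype.sum_prod_type]
    simp only [blockDiag_mulVec_apply]
    rfl
  rw [h, Finset.mul_sum]
  refine Finset.sum_congr rfl fun k _ => ?_
  rw [Matrix.add_mulVec, dotProduct_add, Matrix.mulVec_transpose, dotProduct_comm (u k) (u k ᵥ* A k),
    ← Matrix.dotProduct_mulVec]
  ring

lemma exists_dissipation (hN : 2 ≤ N) (hn : 1 ≤ n) (A : Fin N → Matrix (Fin n) (Fin n) ℝ)
    {LC LP : Matrix (Fin N) (Fin N) ℝ} (hLC : IsLaplacian LC) (hLP : IsLaplacian LP)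
    {σ σP η ρ : ℝ} (hσ : 0 ≤ σ) (hσP : 0 < σP) (hη : η < 0)
    (hmean : ∀ m, m ⬝ᵥ (∑ k, (A k + (A k)ᵀ)) *ᵥ m ≤ N * η * (m ⬝ᵥ m))
    (hρ : ∀ k, lambdaMax (A k + (A k)ᵀ) ≤ ρ)
    (hgain : lambdaMax (∑ j, ((A (emb hN j) + (A (emb hN j))ᵀ) -
      (A (e0 hN) + (A (e0 hN))ᵀ)) ^ 2) / (N * |η|) + ρ < 2 * (σ * lambda2 LC + σP * lambda2 LP)) :
    ∃ c : ℝ, 0 < c ∧ ∀ v, v ⬝ᵥ (blockDiag A - (σ • (LC ⊗ₖ (1 : Matrix (Fin n) (Fin n) ℝ)) +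
      σP • (LP ⊗ₖ (1 : Matrix (Fin n) (Fin n) ℝ)))) *ᵥ v ≤ -c * (v ⬝ᵥ v) := by
  have : Nonempty (Fin n) := ⟨⟨0, hn⟩⟩
  have hS : ∀ k, (A k + (A k)ᵀ).IsSymm := fun k => Matrix.isSymm_add_transpose_self (A k)
  have hNpos : (0 : ℝ) < N := by exact_mod_cast (show 0 < N by omega)
  set μ := lambdaMax (∑ j, ((A (emb hN j) + (A (emb hN j))ᵀ) -
    (A (e0 hN) + (A (e0 hN))ᵀ)) ^ 2) with hμ
  have hμ0 : 0 ≤ μ := lambdaMax_sum_sq_nonneg _ fun j => (hS _).sub (hS _)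
  set h : ℝ := N * |η| with hh
  have hhη : h = -(N * η) := by rw [hh, abs_of_neg hη]; ring
  have hpos : 0 < h := mul_pos hNpos (abs_pos.2 hη.ne)
  set β : ℝ := 2 * (σ * lambda2 LC + σP * lambda2 LP) - ρ with hβ
  have hβμ : μ / h < β := by linarith
  have hβ0 : 0 < β := (div_nonneg hμ0 hpos.le).trans_lt hβμ
  rw [div_lt_iff₀ hpos] at hβμ
  obtain ⟨θ, hθ, hθμ, hθβ⟩ : ∃ θ : ℝ, 0 < θ ∧ θ * μ < h ∧ θ⁻¹ < β := by
    refine ⟨2 * h / (β * h + μ), by positivity, ?_, ?_⟩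
    · rw [div_mul_eq_mul_div, div_lt_iff₀ (by positivity)]
      nlinarith
    · rw [inv_div, div_lt_iff₀ (by positivity)]
      linarith
  obtain ⟨c, hc, hc1, hc2⟩ : ∃ c : ℝ, 0 < c ∧ 2 * (c * N) ≤ h - θ * μ ∧ 2 * c ≤ β - θ⁻¹ := by
    refine ⟨min ((h - θ * μ) / (2 * N)) ((β - θ⁻¹) / 2), ?_, ?_, ?_⟩
    · have h1 : 0 < h - θ * μ := by linarith
      have h2 : 0 < β - θ⁻¹ := by linarith
      positivity
    · have := min_le_left ((h - θ * μ) / (2 * N)) ((β - θ⁻¹) / 2)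
      rw [le_div_iff₀ (by positivity)] at this
      linarith
    · linarith [min_le_right ((h - θ * μ) / (2 * N)) ((β - θ⁻¹) / 2)]
  refine ⟨c, hc, fun v => ?_⟩
  obtain ⟨m, e, he, rfl⟩ : ∃ (m : Fin n → ℝ) (e : Fin N → Fin n → ℝ), ∑ k, e k = 0 ∧
      v = fun p => m p.2 + e p.1 p.2 := by
    refine ⟨fun j => (∑ k, v (k, j)) / N, fun k j => v (k, j) - (∑ k, v (k, j)) / N, ?_, ?_⟩
    · ext j
      simp only [Finset.sum_apply, Finset.sum_sub_distrib, Finset.sum_const, Finset.card_univ,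
        Fintype.card_fin, nsmul_eq_mul, Pi.zero_apply]
      field_simp
      ring
    · ext p
      simp
  have hnorm : (fun p : Fin N × Fin n => m p.2 + e p.1 p.2) ⬝ᵥ (fun p => m p.2 + e p.1 p.2)
      = N * (m ⬝ᵥ m) + ∑ k, e k ⬝ᵥ e k := by
    have h0 : m ⬝ᵥ ∑ k, e k = 0 := by rw [he, dotProduct_zero]
    rw [dotProduct_sum] at h0
    have h1 : (fun p : Fin N × Fin n => m p.2 + e p.1 p.2) ⬝ᵥ (fun p => m p.2 + e p.1 p.2)
        = ∑ k, (m + e k) ⬝ᵥ (m + e k) := by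
      rw [dotProduct, Fintype.sum_prod_type]
      rfl
    have h2 : ∀ k, (m + e k) ⬝ᵥ (m + e k) = m ⬝ᵥ m + 2 * (m ⬝ᵥ e k) + e k ⬝ᵥ e k := fun k => by
      rw [add_dotProduct, dotProduct_add, dotProduct_add, dotProduct_comm (e k) m]
      ring
    simp only [h1, h2, Finset.sum_add_distrib, ← Finset.mul_sum, h0, Finset.sum_const,
      Finset.card_univ, Fintype.card_fin, nsmul_eq_mul]
    ring
  have hA := two_mul_dotProduct_blockDiag_mulVec A fun k => m + e k
  have hsum := sum_dotProduct_mulVec_le hN hS m he hθ hρ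
  rw [← hA, ← hμ] at hsum
  have hC := mul_le_mul_of_nonneg_left (hLC.lambda2_mul_le_kronecker m he) hσ
  have hP := mul_le_mul_of_nonneg_left (hLP.lambda2_mul_le_kronecker m he) hσP.le
  have hm0 : 0 ≤ m ⬝ᵥ m := by simpa using dotProduct_star_self_nonneg m
  have he0 : 0 ≤ ∑ k, e k ⬝ᵥ e k :=
    Finset.sum_nonneg fun k _ => by simpa using dotProduct_star_self_nonneg (e k)
  have h1 := mul_le_mul_of_nonneg_right hc1 hm0
  have h2 := mul_le_mul_of_nonneg_right hc2 he0
  have h3 := hmean m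
  rw [Matrix.sub_mulVec, Matrix.add_mulVec, Matrix.smul_mulVec, Matrix.smul_mulVec,
    dotProduct_sub, dotProduct_add, dotProduct_smul, dotProduct_smul, hnorm, smul_eq_mul,
    smul_eq_mul]
  simp only [Pi.add_apply] at hsum
  rw [hβ] at h2
  rw [hhη] at h1
  linarith

end Dissipation

section Coupling

variable {N n : ℕ}

/-- The integral layer admits an inverse on the states whose blocks sum to zero. -/
lemma exists_posDef_inverse_of_isLaplacian (hN : 2 ≤ N) {L : Matrix (Fin N) (Fin N) ℝ}
    (h : IsLaplacian L) (h2 : 0 < lambda2 L) {s : ℝ} (hs : 0 < s) :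
    ∃ Q : Matrix (Fin N × Fin n) (Fin N × Fin n) ℝ, Q.PosDef ∧
      ∀ x z : Fin N × Fin n → ℝ, (∀ j, ∑ k, z (k, j) = 0) →
        z ⬝ᵥ Q *ᵥ ((s • (L ⊗ₖ (1 : Matrix (Fin n) (Fin n) ℝ))) *ᵥ x) = z ⬝ᵥ x := by
  set J : Matrix (Fin N) (Fin N) ℝ := Matrix.of fun _ _ => 1 with hJ
  set G := (s • L + J) ⊗ₖ (1 : Matrix (Fin n) (Fin n) ℝ) with hG
  have hGpos : G.PosDef := (h.posDef_smul_add_ones h2 hs).kronecker Matrix.PosDef.one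
  have hinv : G⁻¹ * G = 1 :=
    Matrix.nonsing_inv_mul _ ((Matrix.isUnit_iff_isUnit_det _).1 hGpos.isUnit)
  have hNpos : (N : ℝ) ≠ 0 := by exact_mod_cast (show N ≠ 0 by omega)
  refine ⟨G⁻¹, hGpos.inv, fun x z hz => ?_⟩
  set w : Fin n → ℝ := fun j => ∑ k, x (k, j) with hw
  have hsplit : G = s • (L ⊗ₖ (1 : Matrix (Fin n) (Fin n) ℝ)) +
      J ⊗ₖ (1 : Matrix (Fin n) (Fin n) ℝ) := by
    rw [hG, Matrix.add_kronecker, Matrix.smul_kronecker]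
  have hJx : ∀ y : Fin N × Fin n → ℝ, (J ⊗ₖ (1 : Matrix (Fin n) (Fin n) ℝ)) *ᵥ y
      = fun p => ∑ k, y (k, p.2) := by
    intro y
    ext ⟨k, j⟩
    rw [kronecker_one_mulVec_apply]
    simp [hJ, Matrix.mulVec, dotProduct]
  have hGw : G *ᵥ (fun p => w p.2) = (N : ℝ) • fun p => w p.2 := by
    rw [hsplit, Matrix.add_mulVec, Matrix.smul_mulVec, h.kronecker_one_mulVec_const, hJx]
    ext p
    simp
  have hQw : G⁻¹ *ᵥ (fun p => w p.2) = (N : ℝ)⁻¹ • fun p => w p.2 := by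
    have h1 := congrArg (G⁻¹ *ᵥ ·) hGw
    simp only [Matrix.mulVec_mulVec, hinv, Matrix.one_mulVec, Matrix.mulVec_smul] at h1
    rw [eq_inv_smul_iff₀ hNpos, ← h1]
  have hzw : z ⬝ᵥ (fun p => w p.2) = 0 := by
    simp only [dotProduct, Fintype.sum_prod_type_right, ← Finset.sum_mul, hz, zero_mul,
      Finset.sum_const_zero]
  have hKx : (s • (L ⊗ₖ (1 : Matrix (Fin n) (Fin n) ℝ))) *ᵥ x = G *ᵥ x - fun p => w p.2 := by
    rw [hsplit, Matrix.add_mulVec, hJx]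
    simp [hw]
  rw [hKx, Matrix.mulVec_sub, Matrix.mulVec_mulVec, hinv, Matrix.one_mulVec, hQw, dotProduct_sub,
    dotProduct_smul, hzw, smul_zero, sub_zero]

lemma IsLaplacian.sum_eq_zero_of_hasDerivWithinAt {L : Matrix (Fin N) (Fin N) ℝ}
    (h : IsLaplacian L) {s : ℝ} {x z : ℝ → Fin N × Fin n → ℝ}
    (hz : ∀ t ∈ Set.Ici (0 : ℝ), HasDerivWithinAt z
      (-(s • ((L ⊗ₖ (1 : Matrix (Fin n) (Fin n) ℝ)) *ᵥ x t))) (Set.Ici 0) t)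
    (hz0 : z 0 = 0) {t : ℝ} (ht : 0 ≤ t) (j : Fin n) : ∑ k, z t (k, j) = 0 := by
  have hd : ∀ u ∈ Set.Ici (0 : ℝ),
      HasDerivWithinAt (fun u => ∑ k, z u (k, j)) 0 (Set.Ici 0) u := by
    intro u hu
    have h1 := HasDerivWithinAt.fun_sum (u := Finset.univ)
      fun k (_ : k ∈ Finset.univ) => hasDerivWithinAt_pi.1 (hz u hu) (k, j)
    refine h1.congr_deriv ?_
    simp only [Pi.neg_apply, Pi.smul_apply, smul_eq_mul, kronecker_one_mulVec_apply,
      Finset.sum_neg_distrib, ← Finset.mul_sum, h.sum_mulVec, mul_zero, neg_zero]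
  have h0 := constant_of_has_deriv_right_zero (a := 0) (b := t)
    (fun u hu => (hd u hu.1).continuousWithinAt.mono Set.Icc_subset_Ici_self)
    (fun u hu => (hd u hu.1).mono (Set.Ici_subset_Ici.2 hu.1)) t ⟨ht, le_rfl⟩
  simpa [hz0] using h0

end Coupling

/-- **Main result** (Theorem 11 of the paper).  Under conditions (i)–(iii) on
the heterogeneous node dynamics and the multiplex control layers, every
trajectory of the closed-loop multiplex PI network converges to the consensus
state `𝟙_N ⊗ x_∞` with `x_∞ = −(1/N)·Ψ₁₁⁻¹·Σ b_k`, and the integral state `z`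
remains bounded. -/
theorem stmt_12 {N n : ℕ} (hN : 2 ≤ N) (hn : 1 ≤ n)
    (A : Fin N → Matrix (Fin n) (Fin n) ℝ) (b : Fin N → Fin n → ℝ)
    (LC LP LI : Matrix (Fin N) (Fin N) ℝ)
    (hLC : IsConnLaplacian LC) (hLP : IsConnLaplacian LP)
    (hLI : IsConnLaplacian LI)
    (σ σP σI : ℝ) (hσ : 0 ≤ σ) (hσP : 0 < σP) (hσI : 0 < σI)
    -- condition (i): `Ψ₁₁` invertible and `Ψ₁₁ + Ψ₁₁ᵀ` negative definite
    (hinv : IsUnit ((1 / (N : ℝ)) • ∑ k, A k).det)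
    (hnegdef : (-(((1 / (N : ℝ)) • ∑ k, A k) +
      ((1 / (N : ℝ)) • ∑ k, A k).transpose)).PosDef)
    -- condition (ii): `σ_P·λ₂(ℒ_P) > (1/2)(μ/(N|η|) + ρ) − σ·λ₂(ℒ_C)`
    (hii : σP * lambda2 LP >
      (1 / 2) *
        (lambdaMax (∑ j : Fin (N - 1),
            ((A (emb hN j) + (A (emb hN j)).transpose) -
              (A (e0 hN) + (A (e0 hN)).transpose)) ^ 2) /
          ((N : ℝ) *
            |lambdaMax (((1 / (N : ℝ)) • ∑ k, A k) +
              ((1 / (N : ℝ)) • ∑ k, A k).transpose)|) +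
        Finset.univ.sup' ⟨e0 hN, Finset.mem_univ _⟩
          (fun k => lambdaMax (A k + (A k).transpose))) -
      σ * lambda2 LC)
    -- condition (iii): `λ₂(ℒ_I) > 0`
    (hiii : 0 < lambda2 LI)
    (x z : ℝ → Fin N × Fin n → ℝ)
    (hx : ∀ t ∈ Set.Ici (0 : ℝ), HasDerivWithinAt x
      ((blockDiag A -
          (σ • (LC ⊗ₖ (1 : Matrix (Fin n) (Fin n) ℝ)) +
            σP • (LP ⊗ₖ (1 : Matrix (Fin n) (Fin n) ℝ)))).mulVec (x t) +
        z t + fun p => b p.1 p.2) (Set.Ici 0) t)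
    (hz : ∀ t ∈ Set.Ici (0 : ℝ), HasDerivWithinAt z
      (-(σI • ((LI ⊗ₖ (1 : Matrix (Fin n) (Fin n) ℝ)).mulVec (x t))))
      (Set.Ici 0) t)
    (hz0 : z 0 = 0) :
    Filter.Tendsto x Filter.atTop
      (nhds (fun p => (-((1 / (N : ℝ)) •
        ((((1 / (N : ℝ)) • ∑ k, A k)⁻¹).mulVec (∑ k, b k)))) p.2)) ∧
    ∃ W : ℝ, ∀ t ∈ Set.Ici (0 : ℝ), ‖z t‖ ≤ W := by
  have : Nonempty (Fin n) := ⟨⟨0, hn⟩⟩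
  have : Nonempty (Fin N) := ⟨e0 hN⟩
  have hNpos : (0 : ℝ) < N := by exact_mod_cast (show 0 < N by omega)
  set Ψ : Matrix (Fin n) (Fin n) ℝ := (1 / (N : ℝ)) • ∑ k, A k with hΨ
  have hAΨ : ∑ k, A k = (N : ℝ) • Ψ := by
    rw [hΨ, smul_smul, mul_one_div_cancel hNpos.ne', one_smul]
  have hη := lambdaMax_neg_of_posDef_neg hnegdef
  have hΨH : (Ψ + Ψᵀ).IsHermitian := by simpa using hnegdef.isHermitian.neg
  obtain ⟨c, hc, hdiss⟩ := exists_dissipation hN hn A hLC.1 hLP.1 hσ hσP hη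
    (ρ := Finset.univ.sup' ⟨e0 hN, Finset.mem_univ _⟩ fun k => lambdaMax (A k + (A k)ᵀ))
    (fun m => by
      rw [Finset.sum_add_distrib, ← Matrix.transpose_sum, hAΨ, Matrix.transpose_smul, ← smul_add,
        Matrix.smul_mulVec, dotProduct_smul, smul_eq_mul, mul_assoc]
      exact mul_le_mul_of_nonneg_left (dotProduct_mulVec_le_lambdaMax hΨH m) hNpos.le)
    (fun k => Finset.le_sup' (fun k => lambdaMax (A k + (A k)ᵀ)) (Finset.mem_univ k))
    (by linarith)
  obtain ⟨Q, hQ, hQK⟩ := exists_posDef_inverse_of_isLaplacian (n := n) hN hLI.1 hiii hσI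
  set M := _root_.blockDiag A - (σ • (LC ⊗ₖ (1 : Matrix (Fin n) (Fin n) ℝ)) +
    σP • (LP ⊗ₖ (1 : Matrix (Fin n) (Fin n) ℝ))) with hM
  set w : Fin n → ℝ := -((1 / (N : ℝ)) • (Ψ⁻¹ *ᵥ ∑ k, b k)) with hw
  set xs : Fin N × Fin n → ℝ := fun p => w p.2 with hxs
  set zs : Fin N × Fin n → ℝ := -(M *ᵥ xs + fun p => b p.1 p.2) with hzs
  have hMxs : ∀ k j, (M *ᵥ xs) (k, j) = (A k *ᵥ w) j := by
    intro k j
    rw [hM, Matrix.sub_mulVec, Matrix.add_mulVec, Matrix.smul_mulVec, Matrix.smul_mulVec, hxs,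
      hLC.1.kronecker_one_mulVec_const, hLP.1.kronecker_one_mulVec_const, smul_zero, smul_zero,
      add_zero, sub_zero, blockDiag_mulVec_apply]
  have hΨw : (N : ℝ) • (Ψ *ᵥ w) = -∑ k, b k := by
    rw [hw, Matrix.mulVec_neg, Matrix.mulVec_smul, Matrix.mulVec_mulVec,
      Matrix.mul_nonsing_inv _ hinv, Matrix.one_mulVec, smul_neg, smul_smul,
      mul_one_div_cancel hNpos.ne', one_smul]
  have hzs_sum : ∀ j, ∑ k, zs (k, j) = 0 := by
    intro j
    have h1 : ∑ k, (A k *ᵥ w) j = -(∑ k, b k) j := by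
      rw [← Pi.neg_apply, ← hΨw, ← Matrix.smul_mulVec, ← hAΨ, Matrix.sum_mulVec, Finset.sum_apply]
    simp only [hzs, Pi.neg_apply, Pi.add_apply, hMxs, Finset.sum_neg_distrib,
      Finset.sum_add_distrib, h1, Finset.sum_apply]
    ring
  have hKxs : (σI • (LI ⊗ₖ (1 : Matrix (Fin n) (Fin n) ℝ))) *ᵥ xs = 0 := by
    rw [Matrix.smul_mulVec, hxs, hLI.1.kronecker_one_mulVec_const, smul_zero]
  obtain ⟨C, γ, hγ, hbound⟩ := exists_exp_bound_of_coupled_mulVec hQ hc hdiss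
    (K := σI • (LI ⊗ₖ (1 : Matrix (Fin n) (Fin n) ℝ)))
    (x := fun t => x t - xs) (z := fun t => z t - zs)
    (fun t ht => ((hx t ht).sub_const xs).congr_deriv (by
      rw [Matrix.mulVec_sub, hzs]
      abel))
    (fun t ht => ((hz t ht).sub_const zs).congr_deriv (by
      rw [Matrix.mulVec_sub, hKxs, sub_zero, Matrix.smul_mulVec]))
    (fun t ht => hQK _ _ fun j => by
      simp only [Pi.sub_apply, Finset.sum_sub_distrib, hzs_sum,
        hLI.1.sum_eq_zero_of_hasDerivWithinAt hz hz0 ht j, sub_zero])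
  constructor
  · have hlim : Filter.Tendsto (fun t => C * Real.exp (-(γ * t))) Filter.atTop (nhds 0) := by
      rw [← mul_zero C]
      exact (Real.tendsto_exp_neg_atTop_nhds_zero.comp
        (Filter.tendsto_id.const_mul_atTop hγ)).const_mul C
    have hsq : Filter.Tendsto (fun t => ‖x t - xs‖ ^ 2) Filter.atTop (nhds 0) := by
      refine tendsto_of_tendsto_of_tendsto_of_le_of_le' tendsto_const_nhds hlim
        (.of_forall fun t => by positivity) ?_
      filter_upwards [Filter.eventually_ge_atTop 0] with t ht
      have := hbound t ht
      nlinarith [sq_nonneg ‖z t - zs‖]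
    rw [tendsto_iff_norm_sub_tendsto_zero]
    have h1 := hsq.sqrt
    simpa [Real.sqrt_sq] using h1
  · refine ⟨C + 1 + ‖zs‖, fun t ht => ?_⟩
    have h1 := hbound t ht
    have h2 : Real.exp (-(γ * t)) ≤ 1 := Real.exp_le_one_iff.2 (neg_nonpos.2 (mul_nonneg hγ.le ht))
    have hC : 0 ≤ C := by
      refine nonneg_of_mul_nonneg_left (le_trans ?_ h1) (Real.exp_pos _)
      positivity
    have h3 : ‖z t - zs‖ ≤ C + 1 := by
      nlinarith [sq_nonneg ‖x t - xs‖, sq_nonneg (‖z t - zs‖ - 1), norm_nonneg (z t - zs)]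
    linarith [norm_le_norm_sub_add (z t) zs]

end
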